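/- Let 0 < φ < θ < π. For every unit quaternion z, dS(z, e^{−iθ} z e^{iφ}) ≥ θ − φ, with equality if and only if z lies on the great circle through 1 and i, i.e., z = cos t + i sin t for some t ∈ ℝ. Consequently the set of points of the diagonal △ = {(x, x)} closest to Σ = {(y, e^{iθ} y e^{−iφ})} (the hot set) is the great circle {(cos t + i sin t, cos t + i sin t) : t ∈ ℝ}. -/

import Mathlib

open Quaternion

/-- The first quaternion imaginary unit `i`. -/
noncomputable def qi : ℍ[ℝ] := ⟨0, 1, 0, 0⟩

/-- `e^{it} = cos t + i sin t` as a quaternion. -/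
noncomputable def eI (t : ℝ) : ℍ[ℝ] := (Real.cos t : ℍ[ℝ]) + (Real.sin t : ℍ[ℝ]) * qi

/-- Geodesic distance on the unit 3-sphere of quaternions: `dS(a,b) = arccos ⟪a, b⟫` where
`⟪a, b⟫ = re(a * star b)`. -/
noncomputable def dS (a b : ℍ[ℝ]) : ℝ := Real.arccos (a * star b).re

/-- Distance in the product metric from the diagonal point `(z, z)` to the great 3-sphere
`Σ = {(y, e^{iθ} y e^{−iφ})}`. -/
noncomputable def dDiag (θ φ : ℝ) (z : ℍ[ℝ]) : ℝ :=
  sInf {v : ℝ | ∃ y : ℍ[ℝ], ‖y‖ = 1 ∧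
    v = Real.sqrt (dS z y ^ 2 + dS z (eI θ * y * eI (-φ)) ^ 2)}

theorem qi_re : qi.re = 0 := rfl
theorem qi_imI : qi.imI = 1 := rfl
theorem qi_imJ : qi.imJ = 0 := rfl
theorem qi_imK : qi.imK = 0 := rfl
theorem eI_re (t : ℝ) : (eI t).re = Real.cos t := by
  simp [eI, Quaternion.re_mul, Quaternion.imI_mul, Quaternion.imJ_mul, Quaternion.imK_mul, qi_re, qi_imI, qi_imJ, qi_imK]
theorem eI_imI (t : ℝ) : (eI t).imI = Real.sin t := by
  simp [eI, Quaternion.re_mul, Quaternion.imI_mul, Quaternion.imJ_mul, Quaternion.imK_mul, qi_re, qi_imI, qi_imJ, qi_imK]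
theorem eI_imJ (t : ℝ) : (eI t).imJ = 0 := by
  simp [eI, Quaternion.re_mul, Quaternion.imI_mul, Quaternion.imJ_mul, Quaternion.imK_mul, qi_re, qi_imI, qi_imJ, qi_imK]
theorem eI_imK (t : ℝ) : (eI t).imK = 0 := by
  simp [eI, Quaternion.re_mul, Quaternion.imI_mul, Quaternion.imJ_mul, Quaternion.imK_mul, qi_re, qi_imI, qi_imJ, qi_imK]

theorem norm_one_iff (z : ℍ[ℝ]) :
    ‖z‖ = 1 ↔ z.re ^ 2 + z.imI ^ 2 + z.imJ ^ 2 + z.imK ^ 2 = 1 := by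
  rw [← Quaternion.normSq_def', Quaternion.normSq_eq_norm_mul_self]
  constructor
  · intro h; rw [h]; norm_num
  · intro h; nlinarith [norm_nonneg z]

theorem norm_eI (t : ℝ) : ‖eI t‖ = 1 := by
  rw [norm_one_iff, eI_re, eI_imI, eI_imJ, eI_imK]
  nlinarith [Real.sin_sq_add_cos_sq t]

theorem exists_eI (z : ℍ[ℝ]) (hz : ‖z‖ = 1) :
    (z.imJ ^ 2 + z.imK ^ 2 = 0) ↔ ∃ t : ℝ, z = eI t := by
  rw [norm_one_iff] at hz
  constructor
  · intro h
    have hJ : z.imJ = 0 := by nlinarith [sq_nonneg z.imJ, sq_nonneg z.imK]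
    have hK : z.imK = 0 := by nlinarith [sq_nonneg z.imJ, sq_nonneg z.imK]
    have hw : ‖(⟨z.re, z.imI⟩ : ℂ)‖ = 1 := by
      rw [Complex.norm_def, Complex.normSq_mk, Real.sqrt_eq_one]
      nlinarith
    have h0 : (⟨z.re, z.imI⟩ : ℂ) ≠ 0 := by
      intro h; rw [h] at hw; simp at hw
    refine ⟨Complex.arg ⟨z.re, z.imI⟩, ?_⟩
    ext
    · rw [eI_re, Complex.cos_arg h0, hw]; simp
    · rw [eI_imI, Complex.sin_arg, hw]; simp
    · rw [eI_imJ, hJ]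
    · rw [eI_imK, hK]
  · rintro ⟨t, rfl⟩
    rw [eI_imJ, eI_imK]; norm_num

theorem inner_formula (θ φ : ℝ) (z : ℍ[ℝ]) :
    (z * star (eI (-θ) * z * eI φ)).re =
      (z.re ^ 2 + z.imI ^ 2) * Real.cos (θ - φ) + (z.imJ ^ 2 + z.imK ^ 2) * Real.cos (θ + φ) := by
  simp only [Quaternion.re_mul, Quaternion.imI_mul, Quaternion.imJ_mul, Quaternion.imK_mul,
    Quaternion.re_star, Quaternion.imI_star, Quaternion.imJ_star, Quaternion.imK_star,
    eI_re, eI_imI, eI_imJ, eI_imK, Real.cos_neg, Real.sin_neg, Real.cos_sub, Real.cos_add]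
  ring

theorem inner_adj (θ φ : ℝ) (z y : ℍ[ℝ]) :
    (z * star (eI θ * y * eI (-φ))).re = (y * star (eI (-θ) * z * eI φ)).re := by
  simp only [Quaternion.re_mul, Quaternion.imI_mul, Quaternion.imJ_mul, Quaternion.imK_mul,
    Quaternion.re_star, Quaternion.imI_star, Quaternion.imJ_star, Quaternion.imK_star,
    eI_re, eI_imI, eI_imJ, eI_imK, Real.cos_neg, Real.sin_neg]
  ring

theorem dS_angle (a b : ℍ[ℝ]) (ha : ‖a‖ = 1) (hb : ‖b‖ = 1) :
    dS a b = InnerProductGeometry.angle a b := by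
  rw [dS, InnerProductGeometry.angle, ha, hb, Quaternion.inner_def]; simp

theorem dS_eI (s t : ℝ) : dS (eI s) (eI t) = Real.arccos (Real.cos (s - t)) := by
  rw [dS]
  congr 1
  simp only [Quaternion.re_mul, 
    Quaternion.re_star, Quaternion.imI_star, Quaternion.imJ_star, Quaternion.imK_star,
    eI_re, eI_imI, eI_imJ, eI_imK, Real.cos_sub]
  ring

theorem eI_mul (s t : ℝ) : eI s * eI t = eI (s + t) := by
  ext <;> simp only [Quaternion.re_mul, Quaternion.imI_mul, Quaternion.imJ_mul, Quaternion.imK_mul,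
    eI_re, eI_imI, eI_imJ, eI_imK, Real.cos_add, Real.sin_add] <;> ring

theorem part1 (θ φ : ℝ) (hφ : 0 < φ) (hφθ : φ < θ) (hθ : θ < Real.pi) (z : ℍ[ℝ]) (hz : ‖z‖ = 1) :
      θ - φ ≤ dS z (eI (-θ) * z * eI φ) ∧
      (dS z (eI (-θ) * z * eI φ) = θ - φ ↔ ∃ t : ℝ, z = eI t) := by
  rw [← exists_eI z hz]
  have hz' := (norm_one_iff z).1 hz
  have hs1 := Real.sin_pos_of_pos_of_lt_pi hφ (hφθ.trans hθ)
  have hs2 := Real.sin_pos_of_pos_of_lt_pi (hφ.trans hφθ) hθ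
  have hs : 0 < Real.sin θ * Real.sin φ := mul_pos hs2 hs1
  have key : (z * star (eI (-θ) * z * eI φ)).re =
      Real.cos (θ - φ) - 2 * ((z.imJ ^ 2 + z.imK ^ 2) * (Real.sin θ * Real.sin φ)) := by
    rw [inner_formula, Real.cos_sub, Real.cos_add]
    linear_combination (Real.cos θ * Real.cos φ + Real.sin θ * Real.sin φ) * hz'
  have hq : 0 ≤ z.imJ ^ 2 + z.imK ^ 2 := by positivity
  have hac : Real.arccos (Real.cos (θ - φ)) = θ - φ :=
    Real.arccos_cos (by linarith) (by linarith)
  have hn : ‖eI (-θ) * z * eI φ‖ = 1 := by simp [norm_eI, hz]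
  constructor
  · conv_lhs => rw [← hac]
    unfold dS
    apply Real.arccos_le_arccos
    rw [key]; nlinarith [mul_nonneg hq hs.le]
  · constructor
    · intro h
      have h2 : Real.cos (dS z (eI (-θ) * z * eI φ)) = (z * star (eI (-θ) * z * eI φ)).re := by
        rw [dS_angle _ _ hz hn, InnerProductGeometry.cos_angle, hz, hn, Quaternion.inner_def]
        simp
      rw [h, key] at h2
      have h3 : (z.imJ ^ 2 + z.imK ^ 2) * (Real.sin θ * Real.sin φ) = 0 := by linarith
      exact (mul_eq_zero.1 h3).resolve_right hs.ne'
    · intro h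
      rw [dS, key, h, zero_mul, mul_zero, sub_zero, hac]

theorem dDiag_lower (θ φ : ℝ) (z : ℍ[ℝ]) (hz : ‖z‖ = 1) :
    dS z (eI (-θ) * z * eI φ) / Real.sqrt 2 ≤ dDiag θ φ z := by
  have hn : ‖eI (-θ) * z * eI φ‖ = 1 := by simp [norm_eI, hz]
  apply le_csInf
  · exact ⟨_, z, hz, rfl⟩
  · rintro v ⟨y, hy, rfl⟩
    have e : dS z (eI θ * y * eI (-φ)) = dS y (eI (-θ) * z * eI φ) := by
      unfold dS; rw [inner_adj]
    have tri : dS z (eI (-θ) * z * eI φ) ≤ dS z y + dS y (eI (-θ) * z * eI φ) := by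
      rw [dS_angle _ _ hz hn, dS_angle _ _ hz hy, dS_angle _ _ hy hn]
      exact InnerProductGeometry.angle_le_angle_add_angle _ _ _
    rw [e]
    have h0 : 0 ≤ dS z (eI (-θ) * z * eI φ) := Real.arccos_nonneg _
    apply Real.le_sqrt_of_sq_le
    rw [div_pow, Real.sq_sqrt (by norm_num)]
    have := sq_nonneg (dS z y - dS y (eI (-θ) * z * eI φ))
    have := pow_le_pow_left₀ h0 tri 2
    linarith

theorem dDiag_upper (θ φ : ℝ) (hφ : 0 < φ) (hφθ : φ < θ) (hθ : θ < Real.pi) (t : ℝ) :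
    dDiag θ φ (eI t) ≤ (θ - φ) / Real.sqrt 2 := by
  apply csInf_le
  · refine ⟨0, ?_⟩
    rintro v ⟨y, hy, rfl⟩
    exact Real.sqrt_nonneg _
  · refine ⟨eI (t - (θ - φ) / 2), norm_eI _, ?_⟩
    rw [eI_mul, eI_mul, dS_eI, dS_eI]
    have e1 : t - (t - (θ - φ) / 2) = (θ - φ) / 2 := by ring
    have e2 : t - (θ + (t - (θ - φ) / 2) + -φ) = -((θ - φ) / 2) := by ring
    rw [e1, e2, Real.cos_neg, Real.arccos_cos (by linarith) (by linarith)]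
    symm
    rw [Real.sqrt_eq_iff_mul_self_eq (by positivity) (div_nonneg (by linarith) (by positivity))]
    rw [← pow_two, div_pow _ (√2), Real.sq_sqrt (by norm_num)]
    ring

/-- For `0 < φ < θ < π` and every unit quaternion `z`,
`dS(z, e^{−iθ} z e^{iφ}) ≥ θ − φ`, with equality iff `z = cos t + i sin t` for some `t`.
Consequently the hot set of the diagonal relative to `Σ = {(y, e^{iθ} y e^{−iφ})}` is the
great circle `{(e^{it}, e^{it})}`. -/
theorem hot_circle (θ φ : ℝ) (hφ : 0 < φ) (hφθ : φ < θ) (hθ : θ < Real.pi) :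
    (∀ z : ℍ[ℝ], ‖z‖ = 1 →
      θ - φ ≤ dS z (eI (-θ) * z * eI φ) ∧
      (dS z (eI (-θ) * z * eI φ) = θ - φ ↔ ∃ t : ℝ, z = eI t)) ∧
    (∀ z : ℍ[ℝ], ‖z‖ = 1 →
      ((∀ w : ℍ[ℝ], ‖w‖ = 1 → dDiag θ φ z ≤ dDiag θ φ w) ↔ ∃ t : ℝ, z = eI t)) := by
  refine ⟨part1 θ φ hφ hφθ hθ, fun z hz => ⟨fun h => ?_, ?_⟩⟩
  · have p := part1 θ φ hφ hφθ hθ z hz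
    refine p.2.1 (le_antisymm ?_ p.1)
    have h1 := ((dDiag_lower θ φ z hz).trans (h (eI 0) (norm_eI 0))).trans
      (dDiag_upper θ φ hφ hφθ hθ 0)
    exact (div_le_div_iff_of_pos_right (by positivity)).1 h1
  · rintro ⟨t, rfl⟩ w hw
    refine (dDiag_upper θ φ hφ hφθ hθ t).trans (le_trans ?_ (dDiag_lower θ φ w hw))
    exact (div_le_div_iff_of_pos_right (by positivity)).2 (part1 θ φ hφ hφθ hθ w hw).1
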